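/- arXiv:1707.05995 — 3 statements merged into one kernel-verified Lean document; each statement's English description precedes it below -/
import Mathlib

section
/- There exists a universal constant C > 0 such that for all μ ∈ ℝ and all σ² ≥ 1, sup_{n ∈ ℤ} | TP(μ,σ²){n} − (1/√(2πσ²)) exp(−(n−μ)²/(2σ²)) | ≤ C/σ². -/
open MeasureTheory Real

noncomputable section

/-- Poisson point probability with parameter `lam` at `j`. -/
def poissonPmf (lam : ℝ) (j : ℕ) : ℝ := Real.exp (-lam) * lam ^ j / (Nat.factorial j)

/-- Point probabilities of the translated Poisson distribution `TP(μ, σ²)`: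
the law of `s + Z` where `s = ⌊μ - σ²⌋` and `Z ~ Poisson(σ² + γ)`, `γ = μ - σ² - s`. -/
def TPpmf (μ σ2 : ℝ) (n : ℤ) : ℝ :=
  if 0 ≤ n - ⌊μ - σ2⌋ then
    poissonPmf (σ2 + (μ - σ2 - ⌊μ - σ2⌋)) (n - ⌊μ - σ2⌋).toNat
  else 0

open Complex (I)

theorem norm_cexp_sub_cexp_le {a b : ℂ} {M : ℝ} (ha : a.re ≤ M) (hb : b.re ≤ M) :
    ‖Complex.exp a - Complex.exp b‖ ≤ Real.exp M * ‖a - b‖ := by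
  refine (convex_halfSpace_re_le M).norm_image_sub_le_of_norm_hasDerivWithin_le
    (fun z _ => (Complex.hasDerivAt_exp z).hasDerivWithinAt) (fun z hz => ?_) hb ha
  rw [Complex.norm_exp]
  exact Real.exp_le_exp.2 hz

theorem norm_cexp_mul_I_sub_taylor_le {t : ℝ} (ht : |t| ≤ π) :
    ‖Complex.exp (t * I) - 1 - t * I + t ^ 2 / 2‖ ≤ |t| ^ 3 * Real.exp π := by
  have h := Complex.norm_exp_sub_sum_le_norm_mul_exp (t * I) 3
  have hI : ‖(t * I : ℂ)‖ = |t| := by simp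
  rw [hI] at h
  calc ‖Complex.exp (t * I) - 1 - t * I + t ^ 2 / 2‖
      = ‖Complex.exp (t * I) - ∑ m ∈ Finset.range 3, (t * I : ℂ) ^ m / m.factorial‖ := by
        congr 1
        simp [Finset.sum_range_succ, mul_pow]
        ring
    _ ≤ |t| ^ 3 * Real.exp |t| := h
    _ ≤ |t| ^ 3 * Real.exp π := by gcongr

theorem re_cexp_mul_I_sub_le {t : ℝ} (ht : |t| ≤ π) :
    (Complex.exp (t * I) - 1 - t * I).re ≤ -(t ^ 2 / 5) := by
  have h := Real.cos_le_one_sub_mul_cos_sq ht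
  have h2 : (2 / π ^ 2) * t ^ 2 ≥ 1 / 5 * t ^ 2 := by
    refine mul_le_mul_of_nonneg_right ?_ (sq_nonneg t)
    rw [div_le_div_iff₀ (by norm_num) (by positivity)]
    nlinarith [Real.pi_lt_d2, Real.pi_pos]
  simp [Complex.exp_ofReal_mul_I_re]
  linarith

/-- The centred Poisson characteristic function is close to a Gaussian one. -/
theorem norm_poissonChar_sub_gaussian_le {v lam t : ℝ} (hv : 1 ≤ v) (h1 : v ≤ lam)
    (h2 : lam ≤ v + 1) (ht : |t| ≤ π) :
    ‖Complex.exp (lam * (Complex.exp (t * I) - 1 - t * I)) - Complex.exp (-(v / 2) * t ^ 2)‖ ≤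
      (2 * v * Real.exp π * |t| ^ 3 + t ^ 2 / 2) * Real.exp (-(v * t ^ 2 / 5)) := by
  set w := Complex.exp (t * I) - 1 - t * I with hw
  have hwre : w.re ≤ -(t ^ 2 / 5) := re_cexp_mul_I_sub_le ht
  have ha : ((lam : ℂ) * w).re ≤ -(v * t ^ 2 / 5) := by
    rw [Complex.re_ofReal_mul]
    nlinarith [mul_nonneg (sub_nonneg.2 h1) (sq_nonneg t),
      mul_le_mul_of_nonneg_left hwre (by linarith : 0 ≤ lam)]
  have hb : (-((v : ℂ) / 2) * (t : ℂ) ^ 2).re ≤ -(v * t ^ 2 / 5) := by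
    have : (-((v : ℂ) / 2) * (t : ℂ) ^ 2) = ((-(v / 2) * t ^ 2 : ℝ) : ℂ) := by push_cast; ring
    rw [this, Complex.ofReal_re]
    nlinarith [mul_nonneg (by linarith : 0 ≤ v) (sq_nonneg t)]
  refine (norm_cexp_sub_cexp_le ha hb).trans ?_
  rw [mul_comm]
  gcongr
  have hsplit : (lam : ℂ) * w - -((v : ℂ) / 2) * (t : ℂ) ^ 2 =
      lam * (w + t ^ 2 / 2) - ((lam - v) * t ^ 2 / 2 : ℝ) := by
    push_cast; ring
  rw [hsplit]
  refine (norm_sub_le _ _).trans (add_le_add ?_ ?_)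
  · rw [norm_mul, Complex.norm_real, Real.norm_of_nonneg (by linarith)]
    calc lam * ‖w + t ^ 2 / 2‖ ≤ (2 * v) * (|t| ^ 3 * Real.exp π) := by
          gcongr
          · linarith
          · exact norm_cexp_mul_I_sub_taylor_le ht
      _ = _ := by ring
  · rw [Complex.norm_real, Real.norm_of_nonneg]
    · nlinarith [sq_nonneg t]
    · have := mul_nonneg (sub_nonneg.2 h1) (sq_nonneg t)
      linarith

theorem polynomial_mul_exp_neg_sq_le {E : ℝ} (hE : 0 ≤ E) (x : ℝ) :
    (2 * E * x ^ 3 + x ^ 2 / 2) * Real.exp (-(x ^ 2 / 5)) ≤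
      751 * (4 * E + 1) * (1 + x ^ 2)⁻¹ := by
  have h6 : x ^ 6 ≤ 750 * Real.exp (x ^ 2 / 5) := by
    have := Real.pow_div_factorial_le_exp (x := x ^ 2 / 5) (by positivity) 3
    norm_num [Nat.factorial] at this
    nlinarith
  have h0 : 1 ≤ Real.exp (x ^ 2 / 5) := Real.one_le_exp (by positivity)
  rw [Real.exp_neg, ← div_eq_mul_inv, ← div_eq_mul_inv,
    div_le_div_iff₀ (by positivity) (by positivity)]
  have h35 : x ^ 3 + x ^ 5 ≤ 2 * (1 + x ^ 6) := by
    nlinarith [sq_nonneg (x ^ 3 - 1), sq_nonneg (x ^ 3 - x ^ 2), sq_nonneg (x ^ 2 - 1),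
      sq_nonneg (x ^ 2 - x), sq_nonneg (x - 1), mul_nonneg (sq_nonneg x) (sq_nonneg (x ^ 2 - 1)),
      sq_nonneg (x ^ 3)]
  have h24 : x ^ 2 + x ^ 4 ≤ 2 * (1 + x ^ 6) := by
    nlinarith [sq_nonneg (x ^ 2 - 1), mul_nonneg (sq_nonneg x) (sq_nonneg (x ^ 2 - 1)),
      sq_nonneg (x ^ 3)]
  have h16 : 1 + x ^ 6 ≤ 751 * Real.exp (x ^ 2 / 5) := by linarith
  calc (2 * E * x ^ 3 + x ^ 2 / 2) * (1 + x ^ 2)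
      = 2 * E * (x ^ 3 + x ^ 5) + (x ^ 2 + x ^ 4) / 2 := by ring
    _ ≤ 2 * E * (2 * (1 + x ^ 6)) + (2 * (1 + x ^ 6)) / 2 := by gcongr
    _ = (4 * E + 1) * (1 + x ^ 6) := by ring
    _ ≤ (4 * E + 1) * (751 * Real.exp (x ^ 2 / 5)) := by gcongr
    _ = _ := by ring

theorem gaussian_error_le_cauchy {v E : ℝ} (hv : 1 ≤ v) (hE : 0 ≤ E) (t : ℝ) :
    (2 * v * E * |t| ^ 3 + t ^ 2 / 2) * Real.exp (-(v * t ^ 2 / 5)) ≤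
      751 * (4 * E + 1) / √v * (1 + (√v * t) ^ 2)⁻¹ := by
  have hs : 1 ≤ √v := Real.one_le_sqrt.2 hv
  have hsq : √v ^ 2 = v := Real.sq_sqrt (by linarith)
  have h := polynomial_mul_exp_neg_sq_le hE (√v * |t|)
  have hx : (√v * |t|) ^ 2 = v * t ^ 2 := by rw [mul_pow, hsq, sq_abs]
  have hx' : (√v * t) ^ 2 = v * t ^ 2 := by rw [mul_pow, hsq]
  rw [hx] at h
  rw [hx', div_mul_eq_mul_div, le_div_iff₀ (by positivity)]
  refine le_trans ?_ h
  rw [mul_right_comm]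
  refine mul_le_mul_of_nonneg_right ?_ (Real.exp_pos _).le
  have h2 : √v * t ^ 2 ≤ v * t ^ 2 := by
    gcongr
    nlinarith
  have h3 : (√v * |t|) ^ 3 = √v * v * |t| ^ 3 := by
    rw [mul_pow, pow_succ, hsq]
    ring
  rw [h3]
  linarith

theorem integral_cexp_int_mul_I (m : ℤ) :
    ∫ t in (-π)..π, Complex.exp (m * I * t) = if m = 0 then 2 * (π : ℂ) else 0 := by
  split_ifs with h
  · subst h
    simp
    ring
  · have hm : (m : ℂ) * I ≠ 0 := mul_ne_zero (Int.cast_ne_zero.2 h) Complex.I_ne_zero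
    rw [integral_exp_mul_complex hm, div_eq_zero_iff]
    left
    rw [sub_eq_zero, Complex.exp_eq_exp_iff_exists_int]
    exact ⟨m, by push_cast; ring⟩

/-- Fourier inversion for the Poisson distribution. -/
theorem integral_poissonChar (lam : ℝ) (k : ℤ) :
    ∫ t in (-π)..π, Complex.exp (-k * I * t + lam * (Complex.exp (t * I) - 1)) =
      2 * π * ((if 0 ≤ k then poissonPmf lam k.toNat else 0 : ℝ) : ℂ) := by
  let c : ℕ → ℂ := fun j => Complex.exp (-lam) * lam ^ j / j.factorial
  have hsum : ∀ t : ℝ, HasSum (fun j : ℕ => c j * Complex.exp (((j - k : ℤ) : ℂ) * I * t))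
      (Complex.exp (-k * I * t + lam * (Complex.exp (t * I) - 1))) := by
    intro t
    have h := (NormedSpace.expSeries_div_hasSum_exp (𝔸 := ℂ)
      (lam * Complex.exp (t * I))).mul_left (Complex.exp (-k * I * t - lam))
    rw [← Complex.exp_eq_exp_ℂ, ← Complex.exp_add] at h
    convert! h using 1
    · funext j
      have e1 : Complex.exp (((j - k : ℤ) : ℂ) * I * t) =
          Complex.exp (-k * I * t) * Complex.exp (t * I) ^ j := by
        rw [← Complex.exp_nat_mul, ← Complex.exp_add]
        congr 1
        push_cast
        ring
      simp only [c]
      rw [e1, sub_eq_add_neg, Complex.exp_add, mul_pow]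
      ring
    · congr 1
      ring
  have h_integral := intervalIntegral.hasSum_integral_of_dominated_convergence
    (μ := volume) (a := -π) (b := π)
    (F := fun (j : ℕ) (t : ℝ) => c j * Complex.exp (((j - k : ℤ) : ℂ) * I * t))
    (f := fun t : ℝ => Complex.exp (-k * I * t + lam * (Complex.exp (t * I) - 1)))
    (fun j _ => ‖c j‖)
    (fun j => (by fun_prop : Continuous fun t : ℝ =>
      c j * Complex.exp (((j - k : ℤ) : ℂ) * I * t)).aestronglyMeasurable)
    (fun j => ae_of_all _ fun t _ => by
      have : ((j - k : ℤ) : ℂ) * I * t = (((j - k : ℤ) * t : ℝ) : ℂ) * I := by push_cast; ring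
      rw [norm_mul, this, Complex.norm_exp_ofReal_mul_I, mul_one])
    (ae_of_all _ fun t _ => by
      have h := (NormedSpace.expSeries_div_summable (𝔸 := ℂ) (lam : ℂ)).mul_left
        (Complex.exp (-lam))
      refine Summable.norm (h.congr fun j => ?_)
      simp only [c]
      ring)
    intervalIntegrable_const
    (ae_of_all _ fun t _ => hsum t)
  simp only [intervalIntegral.integral_const_mul, integral_cexp_int_mul_I] at h_integral
  refine h_integral.unique ?_
  split_ifs with hk
  · lift k to ℕ using hk
    have : 2 * (π : ℂ) * (poissonPmf lam ((k : ℤ).toNat) : ℝ) =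
        c k * (if ((k : ℤ) - (k : ℤ)) = 0 then 2 * (π : ℂ) else 0) := by
      simp [poissonPmf, c]
      ring
    rw [this]
    refine hasSum_single k fun j hj => ?_
    rw [if_neg (by omega), mul_zero]
  · convert! hasSum_zero using 1
    · funext j
      rw [if_neg (by omega), mul_zero]
    · simp

/-- Fourier inversion for the Gaussian density. -/
theorem integral_gaussianChar {v : ℝ} (hv : 0 < v) (d : ℝ) :
    ∫ t : ℝ, Complex.exp (-d * I * t) * Complex.exp (-(v / 2) * t ^ 2) =
      2 * π * ((1 / √(2 * π * v) * Real.exp (-d ^ 2 / (2 * v)) : ℝ) : ℂ) := by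
  have h := fourierIntegral_gaussian (b := (v / 2 : ℂ)) (by simpa using hv) (-d)
  have e : ∀ t : ℝ, -(d : ℂ) * I * t = I * (-d) * t := fun t => by ring
  simp only [e, h]
  have h1 : ((π : ℂ) / (v / 2)) ^ (1 / 2 : ℂ) = ((√(2 * π / v) : ℝ) : ℂ) := by
    rw [Real.sqrt_eq_rpow, Complex.ofReal_cpow (by positivity)]
    push_cast
    congr 1
    field_simp
  have h2 : √(2 * π / v) = 2 * π * (1 / √(2 * π * v)) := by
    rw [← Real.sqrt_sq (show 0 ≤ 2 * π by positivity), mul_one_div,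
      ← Real.sqrt_div (by positivity), Real.sqrt_sq (by positivity)]
    congr 1
    field_simp
  rw [h1, h2]
  push_cast
  rw [mul_assoc]
  congr 3
  · congr 1
    field_simp
    ring

theorem integral_inv_one_add_mul_sq {a : ℝ} (ha : 0 < a) :
    ∫ t : ℝ, (1 + (a * t) ^ 2)⁻¹ = π / a := by
  rw [Measure.integral_comp_mul_left (fun x : ℝ => (1 + x ^ 2)⁻¹), integral_univ_inv_one_add_sq,
    abs_of_pos (inv_pos.2 ha), smul_eq_mul, inv_mul_eq_div]

/-- A Poisson point probability differs from a Gaussian density of nearby variance by `O(1 / v)`. -/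
theorem abs_poissonPmf_sub_gaussian_le {v lam : ℝ} (hv : 1 ≤ v) (h1 : v ≤ lam)
    (h2 : lam ≤ v + 1) (k : ℤ) :
    |(if 0 ≤ k then poissonPmf lam k.toNat else 0) -
        1 / √(2 * π * v) * Real.exp (-(k - lam) ^ 2 / (2 * v))| ≤
      751 * (4 * Real.exp π + 1) / v := by
  have hv0 : 0 < v := by linarith
  set K := 751 * (4 * Real.exp π + 1)
  have hKpos : 0 < K := by positivity
  set d : ℝ := k - lam with hd
  set p : ℝ := if 0 ≤ k then poissonPmf lam k.toNat else 0 with hp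
  set q : ℝ := 1 / √(2 * π * v) * Real.exp (-d ^ 2 / (2 * v))
  let P : ℝ → ℂ := fun t => Complex.exp (-d * I * t) *
    Complex.exp (lam * (Complex.exp (t * I) - 1 - t * I))
  let G : ℝ → ℂ := fun t => Complex.exp (-d * I * t) * Complex.exp (-(v / 2) * t ^ 2)
  let P' : ℝ → ℂ := (Set.Ioc (-π) π).indicator P
  have hP : ∫ t, P' t = 2 * π * (p : ℂ) := by
    rw [integral_indicator measurableSet_Ioc,
      ← intervalIntegral.integral_of_le (by linarith [Real.pi_pos]), hp, ← integral_poissonChar]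
    congr 1
    funext t
    simp only [P]
    rw [← Complex.exp_add, hd]
    congr 1
    push_cast
    ring
  have hG : ∫ t, G t = 2 * π * (q : ℂ) := integral_gaussianChar hv0 d
  have hPint : Integrable P' := by
    rw [integrable_indicator_iff measurableSet_Ioc]
    exact (by fun_prop : Continuous P).integrableOn_Ioc
  have hGint : Integrable G := by
    have h := integrable_cexp_quadratic (b := (v / 2 : ℂ)) (by simpa using hv0) (-d * I) 0
    refine h.congr (ae_of_all _ fun t => ?_)
    simp only [G]
    rw [← Complex.exp_add]
    congr 1
    ring
  have hdiff : ∫ t, (P' t - G t) = ((2 * π * (p - q) : ℝ) : ℂ) := by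
    rw [integral_sub hPint hGint, hP, hG]
    push_cast
    ring
  have hnorm : ∀ t : ℝ, ‖Complex.exp (-d * I * t)‖ = 1 := fun t => by
    have : -(d : ℂ) * I * t = ((-d * t : ℝ) : ℂ) * I := by push_cast; ring
    rw [this, Complex.norm_exp_ofReal_mul_I]
  have hbound : ∀ t, ‖P' t - G t‖ ≤ K / √v * (1 + (√v * t) ^ 2)⁻¹ := by
    intro t
    refine le_trans ?_ (gaussian_error_le_cauchy hv (Real.exp_pos π).le t)
    by_cases ht : t ∈ Set.Ioc (-π) π
    · simp only [P', G, Set.indicator_of_mem ht, P]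
      rw [← mul_sub, norm_mul, hnorm, one_mul]
      exact norm_poissonChar_sub_gaussian_le hv h1 h2 (abs_le.2 ⟨ht.1.le, ht.2⟩)
    · simp only [P', G, Set.indicator_of_notMem ht]
      have ht1 : 1 ≤ |t| := by
        by_contra! hlt
        have := abs_lt.1 hlt
        exact ht ⟨by linarith [Real.pi_gt_three], by linarith [Real.pi_gt_three]⟩
      have e : -((v : ℂ) / 2) * (t : ℂ) ^ 2 = ((-(v / 2) * t ^ 2 : ℝ) : ℂ) := by push_cast; ring
      rw [zero_sub, norm_neg, norm_mul, hnorm, one_mul, e, ← Complex.ofReal_exp,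
        Complex.norm_real, Real.norm_of_nonneg (Real.exp_pos _).le]
      have hexp : Real.exp (-(v / 2) * t ^ 2) ≤ Real.exp (-(v * t ^ 2 / 5)) := by
        rw [Real.exp_le_exp]
        nlinarith [mul_nonneg hv0.le (sq_nonneg t)]
      have hone : 1 ≤ 2 * v * Real.exp π * |t| ^ 3 + t ^ 2 / 2 := by
        have hpow : 1 ≤ |t| ^ 3 := one_le_pow₀ ht1
        have hE : 1 ≤ Real.exp π := Real.one_le_exp Real.pi_pos.le
        have : 1 ≤ v * Real.exp π * |t| ^ 3 :=
          one_le_mul_of_one_le_of_one_le (one_le_mul_of_one_le_of_one_le hv hE) hpow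
        linarith [sq_nonneg t]
      exact hexp.trans (le_mul_of_one_le_left (Real.exp_pos _).le hone)
  have hs : 0 < √v := Real.sqrt_pos.2 hv0
  have h_integral : Integrable fun t : ℝ => K / √v * (1 + (√v * t) ^ 2)⁻¹ :=
    (integrable_inv_one_add_sq.comp_mul_left' hs.ne').const_mul _
  have hmain := norm_integral_le_of_norm_le h_integral (ae_of_all _ hbound)
  rw [hdiff, integral_const_mul, integral_inv_one_add_mul_sq hs, Complex.norm_real,
    Real.norm_eq_abs, abs_mul, abs_of_pos Real.two_pi_pos, div_mul_div_comm,
    Real.mul_self_sqrt hv0.le] at hmain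
  have hKv : 0 < K / v := by positivity
  have : 2 * π * |p - q| ≤ 2 * π * (K / v) := by
    refine hmain.trans ?_
    rw [mul_comm K, mul_div_assoc]
    nlinarith [mul_pos Real.pi_pos hKv]
  exact le_of_mul_le_mul_left this Real.two_pi_pos

/-- There is a universal constant `C > 0` such that for all `μ ∈ ℝ` and `σ² ≥ 1`,
`sup_{n ∈ ℤ} |TP(μ,σ²){n} - (2πσ²)^{-1/2} exp(-(n-μ)²/(2σ²))| ≤ C/σ²`. -/
theorem tp_close_to_discretized_normal :
    ∃ C : ℝ, 0 < C ∧ ∀ (μ σ2 : ℝ), 1 ≤ σ2 → ∀ n : ℤ,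
      |TPpmf μ σ2 n -
          (1 / Real.sqrt (2 * Real.pi * σ2)) * Real.exp (-((n : ℝ) - μ) ^ 2 / (2 * σ2))|
        ≤ C / σ2 := by
  refine ⟨751 * (4 * Real.exp π + 1), by positivity, fun μ σ2 hσ n => ?_⟩
  have h := abs_poissonPmf_sub_gaussian_le (lam := σ2 + (μ - σ2 - ⌊μ - σ2⌋)) hσ
    (by linarith [Int.floor_le (μ - σ2)]) (by linarith [Int.lt_floor_add_one (μ - σ2)])
    (n - ⌊μ - σ2⌋)
  have e : ((n - ⌊μ - σ2⌋ : ℤ) : ℝ) - (σ2 + (μ - σ2 - ⌊μ - σ2⌋)) = n - μ := by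
    push_cast
    ring
  rwa [e] at h

end
end

section
/- For every integer k ≥ 1 there exists a constant C(k) such that for all μ ∈ ℝ and all σ² ≥ 1, S_k(TP(μ,σ²)) ≤ C(k)/σ^k. -/
open MeasureTheory Real

noncomputable section

/-- First difference operator `Δh(k) = h(k+1) - h(k)`. -/
def delta (h : ℤ → ℝ) : ℤ → ℝ := fun k => h (k + 1) - h k

/-- Smoothness coefficient `S_l` of a distribution on ℤ given by its pmf `p`:
`S_l(p) = sup { |Σ_k p(k) Δ^l h(k)| : ‖h‖_∞ ≤ 1 }`. -/
def SlPmf (l : ℕ) (p : ℤ → ℝ) : ℝ :=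
  ⨆ h : {h : ℤ → ℝ // ∀ k, |h k| ≤ 1}, |∑' k : ℤ, p k * (delta^[l] h.1) k|

/-- The size-biasing identity `E[Z f(Z)] = lam E[f(Z + 1)]` of the Poisson distribution. -/
lemma hasSum_natCast_mul_poissonPmf_smul {E : Type*} [NormedAddCommGroup E] [NormedSpace ℝ E]
    {lam : ℝ} {f : ℕ → E} {a : E} (h : HasSum (fun n => poissonPmf lam n • f (n + 1)) a) :
    HasSum (fun n => (n * poissonPmf lam n) • f n) (lam • a) := by
  have shifted : HasSum (fun n => ((n + 1 : ℕ) * poissonPmf lam (n + 1)) • f (n + 1))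
      (lam • a) := by
    convert h.const_smul lam using 2 with n
    rw [smul_smul]
    congr 1
    have : (n : ℝ) + 1 ≠ 0 := by positivity
    simp only [poissonPmf, Nat.factorial_succ, Nat.cast_mul, Nat.cast_add, Nat.cast_one, pow_succ]
    field_simp
  simpa using (hasSum_nat_add_iff (f := fun n : ℕ => (n * poissonPmf lam n) • f n) 1).1 shifted

lemma poissonPmf_nonneg {lam : ℝ} (hlam : 0 ≤ lam) (n : ℕ) : 0 ≤ poissonPmf lam n := by
  unfold poissonPmf
  positivity

/-- The convolution operator with the Poisson distribution is the exponential of `lam • (S - 1)`,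
where `S` is the shift. -/
lemma hasSum_poissonPmf_smul_pow {A : Type*} [NormedRing A] [NormedAlgebra ℝ A] [CompleteSpace A]
    (lam : ℝ) (S : A) :
    HasSum (fun n => poissonPmf lam n • S ^ n) (NormedSpace.exp (lam • (S - 1))) := by
  let _ : NormedAlgebra ℚ A := NormedAlgebra.restrictScalars ℚ ℝ A
  have split : lam • (S - 1) = algebraMap ℝ A (-lam) + lam • S := by
    rw [Algebra.algebraMap_eq_smul_one]
    module
  rw [split, NormedSpace.exp_add_of_commute (Algebra.commutes (-lam) (lam • S)),
    ← NormedSpace.algebraMap_exp_comm, ← Real.exp_eq_exp_ℝ, ← Algebra.smul_def]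
  convert (NormedSpace.exp_series_hasSum_exp' (𝕂 := ℝ) (lam • S)).const_smul (rexp (-lam)) using 2
    with n
  rw [smul_pow, smul_smul, smul_smul]
  congr 1
  simp only [poissonPmf]
  ring

lemma hasSum_poissonPmf (lam : ℝ) : HasSum (poissonPmf lam) 1 := by
  simpa using hasSum_poissonPmf_smul_pow lam (1 : ℝ)

lemma hasSum_poissonPmf_mul_sub_sq (lam : ℝ) :
    HasSum (fun n => poissonPmf lam n * ((n : ℝ) - lam) ^ 2) lam := by
  have total := hasSum_poissonPmf lam
  have first : HasSum (fun n => (n * poissonPmf lam n) • (1 : ℝ)) (lam • (1 : ℝ)) :=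
    hasSum_natCast_mul_poissonPmf_smul (f := fun _ => (1 : ℝ)) (by simpa using total)
  have second : HasSum (fun n : ℕ => (n * poissonPmf lam n) • (n : ℝ)) (lam • (lam + 1)) := by
    refine hasSum_natCast_mul_poissonPmf_smul (f := fun n : ℕ => (n : ℝ)) ?_
    have succ_sum := first.add total
    rw [smul_eq_mul, mul_one] at succ_sum
    refine succ_sum.congr_fun fun n => ?_
    simp only [smul_eq_mul]
    push_cast
    ring
  have centred := (second.sub (first.mul_left (2 * lam))).add (total.mul_left (lam ^ 2))
  have value : lam • (lam + 1) - 2 * lam * lam • (1 : ℝ) + lam ^ 2 * 1 = lam := by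
    simp only [smul_eq_mul]
    ring
  rw [value] at centred
  refine centred.congr_fun fun n => ?_
  simp only [smul_eq_mul]
  ring

lemma norm_sub_one_mul_exp_le {A : Type*} [NormedRing A] [NormOneClass A] [NormedAlgebra ℝ A]
    [CompleteSpace A] {S : A} (hS : ‖S‖ ≤ 1) {lam : ℝ} (hlam : 0 < lam) :
    ‖(S - 1) * NormedSpace.exp (lam • (S - 1))‖ ≤ 1 / √lam := by
  set P := NormedSpace.exp (lam • (S - 1))
  have hsum : HasSum (fun n => poissonPmf lam n • S ^ n) P := hasSum_poissonPmf_smul_pow lam S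
  have shift : HasSum (fun n => (n * poissonPmf lam n) • S ^ n) (lam • (S * P)) := by
    refine hasSum_natCast_mul_poissonPmf_smul (f := fun n => S ^ n) ?_
    simpa only [mul_smul_comm, ← pow_succ'] using hsum.mul_left S
  have centred : HasSum (fun n : ℕ => (poissonPmf lam n * ((n : ℝ) - lam)) • S ^ n)
      (lam • ((S - 1) * P)) := by
    rw [sub_mul, one_mul, smul_sub]
    refine (shift.sub (hsum.const_smul lam)).congr_fun fun n => ?_
    module
  have hs : 0 < √lam := Real.sqrt_pos.2 hlam
  have hss : √lam ^ 2 = lam := Real.sq_sqrt hlam.le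
  have bound : ‖lam • ((S - 1) * P)‖ ≤ √lam := by
    have hb := ((hasSum_poissonPmf_mul_sub_sq lam).mul_left (1 / (2 * √lam))).add
      ((hasSum_poissonPmf lam).mul_left (√lam / 2))
    have he : 1 / (2 * √lam) * lam + √lam / 2 * 1 = √lam := by
      nth_rewrite 2 [← hss]
      field_simp
      ring
    rw [he] at hb
    refine centred.norm_le_of_bounded hb fun n => ?_
    have hp := poissonPmf_nonneg hlam.le n
    have hpow : ‖S ^ n‖ ≤ 1 := (norm_pow_le S n).trans (pow_le_one₀ (norm_nonneg S) hS)
    have hamgm : |(n : ℝ) - lam| ≤ 1 / (2 * √lam) * ((n : ℝ) - lam) ^ 2 + √lam / 2 := by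
      have := sq_nonneg (|(n : ℝ) - lam| - √lam)
      rw [← sq_abs ((n : ℝ) - lam)]
      field_simp
      nlinarith
    calc ‖(poissonPmf lam n * ((n : ℝ) - lam)) • S ^ n‖
        = poissonPmf lam n * |(n : ℝ) - lam| * ‖S ^ n‖ := by
          rw [norm_smul, Real.norm_eq_abs, abs_mul, abs_of_nonneg hp]
      _ ≤ poissonPmf lam n * |(n : ℝ) - lam| := mul_le_of_le_one_right (by positivity) hpow
      _ ≤ poissonPmf lam n * (1 / (2 * √lam) * ((n : ℝ) - lam) ^ 2 + √lam / 2) := by gcongr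
      _ = _ := by ring
  rw [norm_smul, Real.norm_eq_abs, abs_of_pos hlam] at bound
  rw [le_div_iff₀ hs]
  nlinarith

/-- Splitting the exponential into `k` equal factors turns the first-order smoothing estimate into
one of order `k`. -/
lemma norm_sub_one_pow_mul_exp_le {A : Type*} [NormedRing A] [NormOneClass A] [NormedAlgebra ℝ A]
    [CompleteSpace A] {S : A} (hS : ‖S‖ ≤ 1) {lam : ℝ} (hlam : 0 < lam) {k : ℕ} (hk : 1 ≤ k) :
    ‖(S - 1) ^ k * NormedSpace.exp (lam • (S - 1))‖ ≤ √k ^ k / √lam ^ k := by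
  let _ : NormedAlgebra ℚ A := NormedAlgebra.restrictScalars ℚ ℝ A
  have hk' : (0 : ℝ) < k := by exact_mod_cast hk
  have split : lam • (S - 1) = k • ((lam / k) • (S - 1)) := by
    rw [← Nat.cast_smul_eq_nsmul ℝ, smul_smul, mul_div_cancel₀ _ hk'.ne']
  have comm : Commute (S - 1) (NormedSpace.exp ((lam / k) • (S - 1))) :=
    ((Commute.refl (S - 1)).smul_right (lam / k)).exp_right
  rw [split, NormedSpace.exp_nsmul, ← comm.mul_pow]
  calc _ ≤ ‖(S - 1) * NormedSpace.exp ((lam / k) • (S - 1))‖ ^ k := norm_pow_le _ _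
    _ ≤ (1 / √(lam / k)) ^ k := by
      gcongr
      exact norm_sub_one_mul_exp_le hS (by positivity)
    _ = √k ^ k / √lam ^ k := by
      rw [Real.sqrt_div hlam.le, one_div_div, div_pow]

lemma exists_hasSum_poissonPmf_smul_iterate {E : Type*} [NormedAddCommGroup E] [NormedSpace ℝ E]
    [CompleteSpace E] [Nontrivial E] {S : E →L[ℝ] E} (hS : ‖S‖ ≤ 1) {lam : ℝ} (hlam : 0 < lam)
    {k : ℕ} (hk : 1 ≤ k) {g : E} (hg : ‖g‖ ≤ 1) :
    ∃ v : E, ‖v‖ ≤ √k ^ k / √lam ^ k ∧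
      HasSum (fun n => poissonPmf lam n • S^[n] ((fun x => S x - x)^[k] g)) v := by
  have iter : ((S - 1) ^ k) g = (fun x => S x - x)^[k] g := by
    rw [FunLike.coe_pow_eq_iterate]
    rfl
  have comm : Commute ((S - 1) ^ k) (NormedSpace.exp (lam • (S - 1))) :=
    ((Commute.refl (S - 1)).smul_right lam).exp_right.pow_left k
  refine ⟨((S - 1) ^ k * NormedSpace.exp (lam • (S - 1))) g,
    (ContinuousLinearMap.unit_le_opNorm _ _ hg).trans (norm_sub_one_pow_mul_exp_le hS hlam hk), ?_⟩
  rw [comm.eq, mul_apply_eq_comp, iter]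
  simpa using (hasSum_poissonPmf_smul_pow lam S).mapL
    (ContinuousLinearMap.apply ℝ E ((fun x => S x - x)^[k] g))

open scoped BoundedContinuousFunction

/-- The shift `h ↦ h (· + 1)` on bounded functions on `ℤ`. -/
def boundedShift : (ℤ →ᵇ ℝ) →L[ℝ] (ℤ →ᵇ ℝ) :=
  LinearMap.mkContinuous
    { toFun := fun h => h.compContinuous ⟨fun n => n + 1, by fun_prop⟩
      map_add' := fun _ _ => rfl
      map_smul' := fun _ _ => rfl } 1 fun h => by
    rw [one_mul]
    exact (BoundedContinuousFunction.norm_le (norm_nonneg h)).2 fun n => h.norm_coe_le_norm (n + 1)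

lemma norm_boundedShift_le : ‖boundedShift‖ ≤ 1 :=
  LinearMap.mkContinuous_norm_le _ zero_le_one _

lemma boundedShift_apply (h : ℤ →ᵇ ℝ) (n : ℤ) : boundedShift h n = h (n + 1) := rfl

lemma boundedShift_iterate_apply (j : ℕ) (h : ℤ →ᵇ ℝ) (n : ℤ) :
    (boundedShift^[j] h) n = h (n + j) := by
  induction j generalizing n with
  | zero => simp
  | succ j ih =>
    rw [Function.iterate_succ_apply', boundedShift_apply, ih]
    congr 1
    push_cast
    ring

lemma coe_boundedShift_sub_iterate (l : ℕ) (h : ℤ →ᵇ ℝ) :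
    ⇑((fun x => boundedShift x - x)^[l] h) = delta^[l] h := by
  induction l with
  | zero => rfl
  | succ l ih =>
    rw [Function.iterate_succ_apply', Function.iterate_succ_apply', ← ih]
    rfl

lemma hasSum_TPpmf_mul {μ σ2 a : ℝ} {g : ℤ → ℝ}
    (h : HasSum (fun j : ℕ => poissonPmf (σ2 + (μ - σ2 - ⌊μ - σ2⌋)) j * g (⌊μ - σ2⌋ + j)) a) :
    HasSum (fun n => TPpmf μ σ2 n * g n) a := by
  have hinj : Function.Injective fun j : ℕ => ⌊μ - σ2⌋ + (j : ℤ) := fun i j hij => by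
    simpa using hij
  refine (hinj.hasSum_iff fun n hn => ?_).1 ?_
  · have : ¬ 0 ≤ n - ⌊μ - σ2⌋ := fun hle => hn ⟨(n - ⌊μ - σ2⌋).toNat, by
      simp only [Int.toNat_of_nonneg hle]
      ring⟩
    rw [TPpmf, if_neg this, zero_mul]
  · convert h using 2 with j
    simp [TPpmf]

/-- For every `k ≥ 1` there is `C(k)` such that for all `μ ∈ ℝ` and `σ² ≥ 1`,
`S_k(TP(μ,σ²)) ≤ C(k)/σ^k`. -/
theorem smoothness_of_translated_poisson :
    ∀ k : ℕ, 1 ≤ k → ∃ C : ℝ, ∀ (μ σ2 : ℝ), 1 ≤ σ2 →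
      SlPmf k (TPpmf μ σ2) ≤ C / (Real.sqrt σ2) ^ k := by
  intro k hk
  refine ⟨√k ^ k, fun μ σ2 hσ => Real.iSup_le (fun h => ?_) (by positivity)⟩
  have hle : σ2 ≤ σ2 + (μ - σ2 - ⌊μ - σ2⌋) := by linarith [Int.floor_le (μ - σ2)]
  set lam := σ2 + (μ - σ2 - ⌊μ - σ2⌋)
  have hσ0 : 0 < σ2 := by linarith
  let f : ℤ →ᵇ ℝ := BoundedContinuousFunction.ofNormedAddCommGroupDiscrete h.1 1 h.2
  have hf : ‖f‖ ≤ 1 := (BoundedContinuousFunction.norm_le zero_le_one).2 h.2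
  have : Nontrivial (ℤ →ᵇ ℝ) :=
    ⟨.const ℤ 0, .const ℤ 1, fun h => zero_ne_one (DFunLike.congr_fun h 0)⟩
  obtain ⟨v, hv, hsum⟩ := exists_hasSum_poissonPmf_smul_iterate norm_boundedShift_le
    (hσ0.trans_le hle) hk hf
  have heval := hsum.mapL (BoundedContinuousFunction.evalCLM ℝ ⌊μ - σ2⌋)
  have hTP : HasSum (fun n => TPpmf μ σ2 n * (delta^[k] h.1) n) (v ⌊μ - σ2⌋) := by
    refine hasSum_TPpmf_mul ?_
    refine heval.congr_fun fun j => ?_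
    rw [map_smul, smul_eq_mul, BoundedContinuousFunction.evalCLM_apply, boundedShift_iterate_apply,
      coe_boundedShift_sub_iterate]
    rfl
  rw [hTP.tsum_eq]
  calc _ ≤ ‖v‖ := v.norm_coe_le_norm _
    _ ≤ √k ^ k / √lam ^ k := hv
    _ ≤ √k ^ k / √σ2 ^ k := by gcongr

end
end

section
/- For every real λ > 0 and every integer k with k ≥ λ, one has 0 ≤ ((k − λ)/λ)·∫_0^λ (t/λ)^k e^{λ − t} dt ≤ 1 − e^{λ − k} ≤ 1. -/
open MeasureTheory Real

/-- For `0 < lam` and `0 ≤ t`, the integrand is at most an exponential. -/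
lemma div_pow_mul_exp_le {lam t : ℝ} (hlam : 0 < lam) (ht : 0 ≤ t) (k : ℕ) :
    (t / lam) ^ k * Real.exp (lam - t) ≤ Real.exp (((k : ℝ) - lam) * (t / lam - 1)) := by
  have hbase : t / lam ≤ Real.exp (t / lam - 1) := by
    linarith [Real.add_one_le_exp (t / lam - 1)]
  calc (t / lam) ^ k * Real.exp (lam - t)
      ≤ Real.exp (t / lam - 1) ^ k * Real.exp (lam - t) := by gcongr
    _ = Real.exp (((k : ℝ) - lam) * (t / lam - 1)) := by
      rw [← Real.exp_nat_mul, ← Real.exp_add]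
      congr 1
      field_simp
      ring

lemma integral_div_mul_exp {lam : ℝ} (hlam : lam ≠ 0) (c : ℝ) :
    ∫ t in (0:ℝ)..lam, c / lam * Real.exp (c * (t / lam - 1)) = 1 - Real.exp (-c) := by
  have hderiv : ∀ t ∈ Set.uIcc 0 lam, HasDerivAt (fun t : ℝ => Real.exp (c * (t / lam - 1)))
      (c / lam * Real.exp (c * (t / lam - 1))) t := fun t _ => by
    convert ((((hasDerivAt_id' t).div_const lam).sub_const 1).const_mul c).exp using 1
    ring
  rw [intervalIntegral.integral_eq_sub_of_hasDerivAt hderiv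
    (Continuous.intervalIntegrable (by fun_prop) _ _)]
  simp [hlam]

/-- For `λ > 0` and an integer `k ≥ λ`,
`0 ≤ ((k-λ)/λ) ∫_0^λ (t/λ)^k e^{λ-t} dt ≤ 1 - e^{λ-k} ≤ 1`. -/
theorem integral_bound_for_k_ge_lambda (lam : ℝ) (hlam : 0 < lam) (k : ℕ) (hk : lam ≤ k) :
    0 ≤ (((k : ℝ) - lam) / lam) * ∫ t in (0:ℝ)..lam, (t / lam) ^ k * Real.exp (lam - t) ∧
    (((k : ℝ) - lam) / lam) * (∫ t in (0:ℝ)..lam, (t / lam) ^ k * Real.exp (lam - t))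
      ≤ 1 - Real.exp (lam - k) ∧
    1 - Real.exp (lam - (k : ℝ)) ≤ 1 := by
  have hc : 0 ≤ ((k : ℝ) - lam) / lam := div_nonneg (sub_nonneg.2 hk) hlam.le
  refine ⟨mul_nonneg hc (intervalIntegral.integral_nonneg hlam.le fun t ht => ?_), ?_, ?_⟩
  · have := ht.1
    positivity
  · rw [← neg_sub (k : ℝ) lam, ← integral_div_mul_exp hlam.ne',
      ← intervalIntegral.integral_const_mul]
    refine intervalIntegral.integral_mono_on hlam.le
      (Continuous.intervalIntegrable (by fun_prop) _ _)
      (Continuous.intervalIntegrable (by fun_prop) _ _) fun t ht => ?_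
    exact mul_le_mul_of_nonneg_left (div_pow_mul_exp_le hlam ht.1 k) hc
  · linarith [Real.exp_pos (lam - (k : ℝ))]
end
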